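/- For all τ, τ′ ∈ ℂ with Im τ > 0 and Im τ′ > 0, and all z ∈ ℂ with θ₁(z|τ′) ≠ 0 (and such that neither gamma factor has a pole), the reflection formula holds: Γ(z | τ,τ′) · Γ(τ′−z | τ,τ′) = i·e^{πiτ′/6}·η_D(τ′) / (e^{πiz}·θ₁(z|τ′)). -/

import Mathlib

/-- Jacobi theta function `θ_a(z|τ)` for `a = 1,2,3,4`. -/
noncomputable def jTheta (a : ℕ) (z τ : ℂ) : ℂ :=
  match a with
  | 1 => -∑' k : ℤ, Complex.exp ((Real.pi : ℂ) * Complex.I * τ * ((k : ℂ) + 1/2)^2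
          + 2 * (Real.pi : ℂ) * Complex.I * (z + 1/2) * ((k : ℂ) + 1/2))
  | 2 => ∑' k : ℤ, Complex.exp ((Real.pi : ℂ) * Complex.I * τ * ((k : ℂ) + 1/2)^2
          + 2 * (Real.pi : ℂ) * Complex.I * z * ((k : ℂ) + 1/2))
  | 3 => ∑' k : ℤ, Complex.exp ((Real.pi : ℂ) * Complex.I * τ * (k : ℂ)^2
          + 2 * (Real.pi : ℂ) * Complex.I * z * (k : ℂ))
  | 4 => ∑' k : ℤ, Complex.exp ((Real.pi : ℂ) * Complex.I * τ * (k : ℂ)^2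
          + 2 * (Real.pi : ℂ) * Complex.I * (z + 1/2) * (k : ℂ))
  | _ => 0

/-- The elliptic gamma function `Γ(z|τ,τ′)`. -/
noncomputable def ellGamma (z τ τ' : ℂ) : ℂ :=
  ∏' p : ℕ × ℕ,
    (1 - Complex.exp (2 * (Real.pi : ℂ) * Complex.I *
        (((p.1 : ℂ) + 1) * τ + ((p.2 : ℂ) + 1) * τ' - z))) /
    (1 - Complex.exp (2 * (Real.pi : ℂ) * Complex.I *
        ((p.1 : ℂ) * τ + (p.2 : ℂ) * τ' + z)))

/-- The Dedekind eta function `η_D(τ)`. -/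
noncomputable def dedekindEtaD (τ : ℂ) : ℂ :=
  Complex.exp ((Real.pi : ℂ) * Complex.I * τ / 12) *
    ∏' k : ℕ, (1 - Complex.exp (2 * (Real.pi : ℂ) * Complex.I * ((k : ℂ) + 1) * τ))

open Filter Topology

section QPochhammer

variable {p q x : ℂ}

lemma one_sub_pow_succ_ne_zero (hp : ‖p‖ < 1) (n : ℕ) : 1 - p ^ (n + 1) ≠ 0 := by
  intro h
  have h1 : ‖p ^ (n + 1)‖ < 1 := by
    rw [norm_pow]
    exact pow_lt_one₀ (norm_nonneg _) hp n.succ_ne_zero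
  rw [← sub_eq_zero.mp h] at h1
  simp at h1

lemma summable_norm_neg_mul_pow (hp : ‖p‖ < 1) (y : ℂ) :
    Summable fun n : ℕ ↦ ‖-(y * p ^ n)‖ := by
  simpa using (summable_geometric_of_lt_one (norm_nonneg _) hp).mul_left ‖y‖

lemma multipliable_one_sub_mul_pow (hp : ‖p‖ < 1) (y : ℂ) :
    Multipliable fun n : ℕ ↦ 1 - y * p ^ n := by
  simpa [sub_eq_add_neg] using multipliable_one_add_of_summable (summable_norm_neg_mul_pow hp y)

lemma tprod_one_sub_pow_succ_ne_zero (hp : ‖p‖ < 1) : ∏' n : ℕ, (1 - p ^ (n + 1)) ≠ 0 := by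
  have h := tprod_one_add_ne_zero_of_summable (f := fun n : ℕ ↦ -(p * p ^ n))
    (fun n ↦ by simpa [sub_eq_add_neg, pow_succ'] using one_sub_pow_succ_ne_zero hp n)
    (summable_norm_neg_mul_pow hp p)
  simpa [sub_eq_add_neg, pow_succ'] using h

/-- The reciprocal `1 / ((1 - p) ⋯ (1 - p ^ k))`, extended by zero to negative integers `k`. -/
noncomputable def invQFactorial (p : ℂ) (k : ℤ) : ℂ :=
  if 0 ≤ k then (∏ i ∈ Finset.range k.toNat, (1 - p ^ (i + 1)))⁻¹ else 0

lemma invQFactorial_sub_one (hp : ‖p‖ < 1) (k : ℤ) :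
    invQFactorial p (k - 1) = (1 - p ^ k) * invQFactorial p k := by
  rcases lt_trichotomy k 0 with hk | rfl | hk
  · rw [invQFactorial, invQFactorial, if_neg (by omega), if_neg (by omega), mul_zero]
  · simp [invQFactorial]
  · obtain ⟨n, rfl⟩ : ∃ n : ℕ, k = n + 1 := ⟨(k - 1).toNat, by omega⟩
    have h1 : ((n : ℤ) + 1).toNat = n + 1 := by omega
    rw [invQFactorial, invQFactorial, if_pos (by omega), if_pos (by omega), h1,
      Finset.prod_range_succ, add_sub_cancel_right, Int.toNat_natCast, mul_inv]
    have := one_sub_pow_succ_ne_zero hp n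
    norm_cast
    field_simp

lemma tendsto_invQFactorial (hp : ‖p‖ < 1) :
    Tendsto (invQFactorial p) atTop (𝓝 (∏' n : ℕ, (1 - p ^ (n + 1)))⁻¹) := by
  have hm : Multipliable fun n : ℕ ↦ 1 - p ^ (n + 1) := by
    simpa [pow_succ'] using multipliable_one_sub_mul_pow hp p
  have htoNat : Tendsto Int.toNat atTop atTop :=
    tendsto_atTop.mpr fun b ↦ (eventually_ge_atTop (b : ℤ)).mono fun k hk ↦ by omega
  have h := (hm.tendsto_prod_tprod_nat.inv₀ (tprod_one_sub_pow_succ_ne_zero hp)).comp htoNat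
  refine h.congr' ((eventually_ge_atTop 0).mono fun k hk ↦ ?_)
  simp [invQFactorial, hk]

lemma exists_norm_invQFactorial_le (hp : ‖p‖ < 1) : ∃ C, ∀ k, ‖invQFactorial p k‖ ≤ C := by
  have h := (tendsto_invQFactorial hp).comp tendsto_natCast_atTop_atTop
  obtain ⟨C, hC⟩ := h.norm.bddAbove_range
  refine ⟨max C 0, fun k ↦ ?_⟩
  by_cases hk : 0 ≤ k
  · lift k to ℕ using hk
    exact (hC ⟨k, rfl⟩).trans (le_max_left _ _)
  · simp [invQFactorial, hk]

/-- Finite form of the Jacobi triple product identity. -/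
lemma hasSum_mul_invQFactorial (hp : ‖p‖ < 1) (hp0 : p ≠ 0) (hx : x ≠ 0) {t : ℤ → ℂ}
    (ht0 : t 0 = 1) (ht : ∀ m, t (m + 1) = -(x * p ^ m * t m)) (N : ℕ) :
    HasSum (fun m ↦ (∏ i ∈ Finset.range (2 * N), (1 - p ^ (i + 1))) *
        (invQFactorial p (N + m) * invQFactorial p (N - m)) * t m)
      (∏ n ∈ Finset.range N, ((1 - x * p ^ n) * (1 - p / x * p ^ n))) := by
  induction N with
  | zero =>
    convert hasSum_single (0 : ℤ) ?_ using 1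
    · simp [invQFactorial, ht0]
    · intro m hm
      rcases lt_or_gt_of_ne hm with h | h <;> simp [invQFactorial, h]
  | succ N ih =>
    rw [Finset.prod_range_succ]
    have hup := (Equiv.addRight (1 : ℤ)).hasSum_iff.mpr ih
    have hdown := (Equiv.subRight (1 : ℤ)).hasSum_iff.mpr ih
    have key := ((ih.mul_left (1 + p ^ (2 * N + 1))).add (hdown.mul_left (-(p ^ N * x)))).add
      (hup.mul_left (-(p ^ (N + 1) / x)))
    have hval (a : ℂ) : a * ((1 - x * p ^ N) * (1 - p / x * p ^ N)) =
        (1 + p ^ (2 * N + 1)) * a + -(p ^ N * x) * a + -(p ^ (N + 1) / x) * a := by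
      field_simp
      ring
    rw [hval]
    refine key.congr_fun fun m ↦ ?_
    have hpm := zpow_ne_zero m hp0
    have h1 := invQFactorial_sub_one hp (N + m + 1)
    have h2 := invQFactorial_sub_one hp (N + m)
    have h3 := invQFactorial_sub_one hp (N - m + 1)
    have h4 := invQFactorial_sub_one hp (N - m)
    rw [add_sub_cancel_right] at h1 h3
    rw [h1] at h2
    rw [h3] at h4
    have htd : t (m - 1) = -(p * t m) / (x * p ^ m) := by
      have := ht (m - 1)
      rw [sub_add_cancel, zpow_sub_one₀ hp0] at this
      rw [this]
      field_simp
    simp only [Function.comp_apply, Equiv.coe_addRight, Equiv.subRight_apply]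
    rw [show (N : ℤ) + (m - 1) = N + m - 1 by ring, show (N : ℤ) - (m - 1) = N - m + 1 by ring,
      show (N : ℤ) + (m + 1) = N + m + 1 by ring, show (N : ℤ) - (m + 1) = N - m - 1 by ring,
      show ((N + 1 : ℕ) : ℤ) + m = N + m + 1 by push_cast; ring,
      show ((N + 1 : ℕ) : ℤ) - m = N - m + 1 by push_cast; ring,
      h2, h4, h1, h3, htd, ht, show 2 * (N + 1) = 2 * N + 1 + 1 by ring,
      Finset.prod_range_succ, Finset.prod_range_succ]
    simp only [zpow_add₀ hp0, zpow_sub₀ hp0, zpow_natCast, zpow_one]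
    field_simp
    ring

/-- The **Jacobi triple product identity**. The summand `t m = (-x) ^ m * p ^ (m * (m - 1) / 2)` is
described by its recurrence. -/
theorem tprod_mul_tprod_mul_tprod_eq_tsum (hp : ‖p‖ < 1) (hp0 : p ≠ 0) (hx : x ≠ 0) {t : ℤ → ℂ}
    (ht0 : t 0 = 1) (ht : ∀ m, t (m + 1) = -(x * p ^ m * t m)) (hs : Summable t) :
    (∏' n : ℕ, (1 - p ^ (n + 1))) * ((∏' n : ℕ, (1 - x * p ^ n)) * ∏' n : ℕ, (1 - p / x * p ^ n)) =
      ∑' m, t m := by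
  have hm : Multipliable fun n : ℕ ↦ 1 - p ^ (n + 1) := by
    simpa [pow_succ'] using multipliable_one_sub_mul_pow hp p
  have hne := tprod_one_sub_pow_succ_ne_zero hp
  have hlim := hm.tendsto_prod_tprod_nat.comp
    (tendsto_id.const_mul_atTop' (show 0 < 2 by norm_num))
  obtain ⟨C, hC⟩ := exists_norm_invQFactorial_le hp
  obtain ⟨B, hB⟩ := hlim.norm.bddAbove_range
  have hQ (m : ℤ) : Tendsto (fun N : ℕ ↦ invQFactorial p (N + m)) atTop
      (𝓝 (∏' n : ℕ, (1 - p ^ (n + 1)))⁻¹) :=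
    (tendsto_invQFactorial hp).comp
      (tendsto_atTop_add_const_right _ m tendsto_natCast_atTop_atTop)
  have hsum := tendsto_tsum_of_dominated_convergence (𝓕 := atTop)
    (f := fun (N : ℕ) m ↦ (∏ i ∈ Finset.range (2 * N), (1 - p ^ (i + 1))) *
        (invQFactorial p (N + m) * invQFactorial p (N - m)) * t m)
    (g := fun m ↦ (∏' n : ℕ, (1 - p ^ (n + 1)))⁻¹ * t m)
    (bound := fun m ↦ B * (C * C) * ‖t m‖) (hs.norm.mul_left _)
    (fun m ↦ by
      have h := (hlim.mul ((hQ m).mul (hQ (-m)))).mul_const (t m)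
      rwa [mul_inv_cancel_left₀ hne] at h)
    (Eventually.of_forall fun N m ↦ by
      rw [norm_mul, norm_mul, norm_mul]
      have hB' := hB ⟨N, rfl⟩
      have hB0 : 0 ≤ B := (norm_nonneg _).trans hB'
      have hC0 : 0 ≤ C := (norm_nonneg _).trans (hC 0)
      gcongr
      · exact hB'
      · exact hC _
      · exact hC _)
  simp_rw [fun N ↦ (hasSum_mul_invQFactorial hp hp0 hx ht0 ht N).tsum_eq, tsum_mul_left,
    Finset.prod_mul_distrib] at hsum
  have hprod := (multipliable_one_sub_mul_pow hp x).tendsto_prod_tprod_nat.mul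
    (multipliable_one_sub_mul_pow hp (p / x)).tendsto_prod_tprod_nat
  rw [tendsto_nhds_unique hprod hsum, mul_inv_cancel_left₀ hne]

lemma summable_norm_neg_mul_pow_mul_pow (hq : ‖q‖ < 1) (hp : ‖p‖ < 1) (y : ℂ) :
    Summable fun i : ℕ × ℕ ↦ ‖-(y * q ^ i.1 * p ^ i.2)‖ := by
  have h := ((summable_geometric_of_lt_one (norm_nonneg _) hq).mul_of_nonneg
    (summable_geometric_of_lt_one (norm_nonneg _) hp) (fun n ↦ by positivity)
    (fun n ↦ by positivity)).mul_left ‖y‖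
  simpa [mul_assoc] using h

lemma multipliable_one_sub_mul_pow_mul_pow (hq : ‖q‖ < 1) (hp : ‖p‖ < 1) (y : ℂ) :
    Multipliable fun i : ℕ × ℕ ↦ 1 - y * q ^ i.1 * p ^ i.2 := by
  simpa [sub_eq_add_neg] using
    multipliable_one_add_of_summable (summable_norm_neg_mul_pow_mul_pow hq hp y)

lemma tprod_one_sub_mul_pow_mul_pow_ne_zero (hq : ‖q‖ < 1) (hp : ‖p‖ < 1) {y : ℂ}
    (hy : ∀ i : ℕ × ℕ, 1 - y * q ^ i.1 * p ^ i.2 ≠ 0) :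
    ∏' i : ℕ × ℕ, (1 - y * q ^ i.1 * p ^ i.2) ≠ 0 := by
  have h := tprod_one_add_ne_zero_of_summable
    (f := fun i : ℕ × ℕ ↦ -(y * q ^ i.1 * p ^ i.2))
    (fun i ↦ by simpa [sub_eq_add_neg] using hy i) (summable_norm_neg_mul_pow_mul_pow hq hp y)
  simpa [sub_eq_add_neg] using h

lemma tprod_one_sub_mul_pow_mul_pow_eq (hq : ‖q‖ < 1) (hp : ‖p‖ < 1) (y : ℂ) :
    ∏' i : ℕ × ℕ, (1 - y * q ^ i.1 * p ^ i.2) =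
      (∏' n : ℕ, (1 - y * p ^ n)) * ∏' i : ℕ × ℕ, (1 - q * y * q ^ i.1 * p ^ i.2) := by
  have hm (y : ℂ) := multipliable_one_sub_mul_pow_mul_pow hq hp y
  have hf (y : ℂ) (a : ℕ) := multipliable_one_sub_mul_pow hp (y * q ^ a)
  have hs (a : ℕ) : q * y * q ^ a = y * q ^ (a + 1) := by ring
  rw [(hm y).tprod_prod' (hf y), (hm (q * y)).tprod_prod' (hf (q * y))]
  have h := ((hm (q * y)).hasProd.prod_fiberwise fun a ↦ (hf (q * y) a).hasProd).multipliable
  simp only [hs] at h ⊢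
  rw [tprod_eq_zero_mul' h]
  simp

end QPochhammer

lemma norm_exp_two_pi_I_mul_lt_one {τ : ℂ} (hτ : 0 < τ.im) :
    ‖Complex.exp (2 * Real.pi * Complex.I * τ)‖ < 1 := by
  simpa using UpperHalfPlane.norm_exp_two_pi_I_lt_one ⟨τ, hτ⟩

lemma exp_two_pi_I_mul_add (τ τ' w : ℂ) (a b : ℕ) :
    Complex.exp (2 * Real.pi * Complex.I * (a * τ + b * τ' + w)) =
      Complex.exp (2 * Real.pi * Complex.I * w) * Complex.exp (2 * Real.pi * Complex.I * τ) ^ a *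
        Complex.exp (2 * Real.pi * Complex.I * τ') ^ b := by
  rw [← Complex.exp_nat_mul, ← Complex.exp_nat_mul, ← Complex.exp_add, ← Complex.exp_add]
  ring_nf

/-- The elliptic gamma function as a quotient of two convergent double products. -/
lemma ellGamma_eq_div {τ τ' w : ℂ} (hτ : 0 < τ.im) (hτ' : 0 < τ'.im)
    (hw : ∀ k k' : ℕ, 1 - Complex.exp (2 * Real.pi * Complex.I * (k * τ + k' * τ' + w)) ≠ 0) :
    ellGamma w τ τ' =
      (∏' i : ℕ × ℕ, (1 - Complex.exp (2 * Real.pi * Complex.I * (τ + τ' - w)) *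
        Complex.exp (2 * Real.pi * Complex.I * τ) ^ i.1 *
        Complex.exp (2 * Real.pi * Complex.I * τ') ^ i.2)) /
      ∏' i : ℕ × ℕ, (1 - Complex.exp (2 * Real.pi * Complex.I * w) *
        Complex.exp (2 * Real.pi * Complex.I * τ) ^ i.1 *
        Complex.exp (2 * Real.pi * Complex.I * τ') ^ i.2) := by
  have hq := norm_exp_two_pi_I_mul_lt_one hτ
  have hp := norm_exp_two_pi_I_mul_lt_one hτ'
  have hne := tprod_one_sub_mul_pow_mul_pow_ne_zero hq hp
    (y := Complex.exp (2 * Real.pi * Complex.I * w)) fun i ↦ by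
      rw [← exp_two_pi_I_mul_add]
      exact hw i.1 i.2
  rw [← ((multipliable_one_sub_mul_pow_mul_pow hq hp _).hasProd.div₀
    (multipliable_one_sub_mul_pow_mul_pow hq hp _).hasProd hne).tprod_eq, ellGamma]
  simp_rw [← exp_two_pi_I_mul_add]
  congr! 6
  ring

/-- Product formula for `θ₁`. -/
lemma jTheta_one_eq {τ : ℂ} (hτ : 0 < τ.im) (z : ℂ) :
    jTheta 1 z τ = Complex.I * Complex.exp (Real.pi * Complex.I * τ / 4) *
      Complex.exp (-(Real.pi * Complex.I * z)) *
      ((∏' n : ℕ, (1 - Complex.exp (2 * Real.pi * Complex.I * τ) ^ (n + 1))) *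
      ((∏' n : ℕ, (1 - Complex.exp (2 * Real.pi * Complex.I * z) *
        Complex.exp (2 * Real.pi * Complex.I * τ) ^ n)) *
      ∏' n : ℕ, (1 - Complex.exp (2 * Real.pi * Complex.I * (τ - z)) *
        Complex.exp (2 * Real.pi * Complex.I * τ) ^ n))) := by
  set t : ℤ → ℂ := fun m ↦ jacobiTheta₂_term m (z + 1 / 2 - τ / 2) τ with ht
  have hneg : Complex.exp (Real.pi * Complex.I) = -1 := Complex.exp_pi_mul_I
  have hstep (m : ℤ) : t (m + 1) = -(Complex.exp (2 * Real.pi * Complex.I * z) *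
      Complex.exp (2 * Real.pi * Complex.I * τ) ^ m * t m) := by
    rw [← neg_one_mul, ← hneg, ← Complex.exp_int_mul]
    simp only [ht, jacobiTheta₂_term, ← Complex.exp_add]
    congr 1
    push_cast
    ring
  have hdiv : Complex.exp (2 * Real.pi * Complex.I * (τ - z)) =
      Complex.exp (2 * Real.pi * Complex.I * τ) / Complex.exp (2 * Real.pi * Complex.I * z) := by
    rw [← Complex.exp_sub, mul_sub]
  rw [hdiv, tprod_mul_tprod_mul_tprod_eq_tsum (norm_exp_two_pi_I_mul_lt_one hτ)
    (Complex.exp_ne_zero _) (Complex.exp_ne_zero _) (by simp [ht, jacobiTheta₂_term]) hstep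
    ((summable_jacobiTheta₂_term_iff _ _).mpr hτ), ← (Equiv.addRight (1 : ℤ)).tsum_eq t,
    ← tsum_mul_left]
  have hI : Complex.I = -Complex.exp (-(Real.pi * Complex.I / 2)) := by
    rw [Complex.exp_neg, show (Real.pi * Complex.I / 2 : ℂ) = Real.pi / 2 * Complex.I by ring,
      Complex.exp_pi_div_two_mul_I]
    simp
  rw [jTheta, ← tsum_neg]
  refine tsum_congr fun k ↦ ?_
  nth_rw 3 [hI]
  simp only [ht, jacobiTheta₂_term, neg_mul, ← Complex.exp_add, Equiv.coe_addRight]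
  congr 2
  push_cast
  ring

/-- Reflection formula for the elliptic gamma function:
`Γ(z|τ,τ′)·Γ(τ′−z|τ,τ′) = i·e^{πiτ′/6}·η_D(τ′) / (e^{πiz}·θ₁(z|τ′))`. -/
theorem ellGamma_reflection (τ τ' : ℂ) (hτ : 0 < τ.im) (hτ' : 0 < τ'.im) (z : ℂ)
    (hz : jTheta 1 z τ' ≠ 0)
    (hdef : ∀ k k' : ℕ,
      1 - Complex.exp (2 * (Real.pi : ℂ) * Complex.I * ((k : ℂ)*τ + (k' : ℂ)*τ' + z)) ≠ 0 ∧
      1 - Complex.exp (2 * (Real.pi : ℂ) * Complex.I * ((k : ℂ)*τ + (k' : ℂ)*τ' + (τ' - z))) ≠ 0) :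
    ellGamma z τ τ' * ellGamma (τ' - z) τ τ'
      = Complex.I * Complex.exp ((Real.pi : ℂ) * Complex.I * τ' / 6) * dedekindEtaD τ' /
          (Complex.exp ((Real.pi : ℂ) * Complex.I * z) * jTheta 1 z τ') := by
  have hq := norm_exp_two_pi_I_mul_lt_one hτ
  have hp := norm_exp_two_pi_I_mul_lt_one hτ'
  have h1 := fun k k' ↦ (hdef k k').1
  have h2 := fun k k' ↦ (hdef k k').2
  have hs1 : Complex.exp (2 * Real.pi * Complex.I * (τ + τ' - (τ' - z))) =
      Complex.exp (2 * Real.pi * Complex.I * τ) * Complex.exp (2 * Real.pi * Complex.I * z) := by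
    rw [← Complex.exp_add]
    ring_nf
  have hs2 : Complex.exp (2 * Real.pi * Complex.I * (τ + τ' - z)) =
      Complex.exp (2 * Real.pi * Complex.I * τ) *
        Complex.exp (2 * Real.pi * Complex.I * (τ' - z)) := by
    rw [← Complex.exp_add]
    ring_nf
  have hE1 := tprod_one_sub_mul_pow_mul_pow_ne_zero hq hp
    (y := Complex.exp (2 * Real.pi * Complex.I * z)) fun i ↦ by
      rw [← exp_two_pi_I_mul_add]
      exact h1 i.1 i.2
  have hE2 := tprod_one_sub_mul_pow_mul_pow_ne_zero hq hp
    (y := Complex.exp (2 * Real.pi * Complex.I * (τ' - z))) fun i ↦ by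
      rw [← exp_two_pi_I_mul_add]
      exact h2 i.1 i.2
  have heta : dedekindEtaD τ' = Complex.exp (Real.pi * Complex.I * τ' / 12) *
      ∏' n : ℕ, (1 - Complex.exp (2 * Real.pi * Complex.I * τ') ^ (n + 1)) := by
    rw [dedekindEtaD]
    congr! 4 with n
    rw [← Complex.exp_nat_mul]
    push_cast
    ring_nf
  have hexp : Complex.exp (Real.pi * Complex.I * τ' / 4) =
      Complex.exp (Real.pi * Complex.I * τ' / 6) *
        Complex.exp (Real.pi * Complex.I * τ' / 12) := by
    rw [← Complex.exp_add]
    ring_nf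
  have hP := tprod_one_sub_pow_succ_ne_zero hp
  rw [ellGamma_eq_div hτ hτ' h1, ellGamma_eq_div hτ hτ' h2, hs1, hs2, heta, jTheta_one_eq hτ' z,
    hexp, Complex.exp_neg]
  rw [tprod_one_sub_mul_pow_mul_pow_eq hq hp] at hE1 hE2
  rw [tprod_one_sub_mul_pow_mul_pow_eq hq hp (Complex.exp (2 * Real.pi * Complex.I * z)),
    tprod_one_sub_mul_pow_mul_pow_eq hq hp (Complex.exp (2 * Real.pi * Complex.I * (τ' - z)))]
  have hD1 := left_ne_zero_of_mul hE1
  have hD2 := left_ne_zero_of_mul hE2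
  have hF1 := right_ne_zero_of_mul hE1
  have hF2 := right_ne_zero_of_mul hE2
  have hI := Complex.I_ne_zero
  have he1 := Complex.exp_ne_zero (Real.pi * Complex.I * z)
  have he2 := Complex.exp_ne_zero (Real.pi * Complex.I * τ' / 6)
  have he3 := Complex.exp_ne_zero (Real.pi * Complex.I * τ' / 12)
  generalize Complex.exp (Real.pi * Complex.I * z) = e1 at *
  generalize Complex.exp (Real.pi * Complex.I * τ' / 6) = e2 at *
  generalize Complex.exp (Real.pi * Complex.I * τ' / 12) = e3 at *
  field_simp
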